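/- Let G be a simple graph on a vertex set V with |V| = n such that for every pair of disjoint sets U, W ⊆ V with |U| ≥ n/15 and |W| ≥ n/15 there exist u ∈ U and w ∈ W adjacent in G. Let L, R ⊆ V be disjoint sets with |L| ≥ n/5 and |R| ≥ n/5, and let H be the bipartite graph on the vertex set L ∪ R whose edges are exactly the edges of G having one endpoint in L and one endpoint in R. Then H has a connected component containing at least n/15 vertices. -/

import Mathlib

/-- If every fibre of `f` has fewer than `a` points, and some edge joins any two `a`-large sets
while `f` identifies the endpoints of all edges between `L` and `R`, then a `3a`-large pair
`L`, `R` cannot be split by `f`: every union of fibres meets both sides in fewer than `a` points. -/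
theorem card_filter_mem_lt_of_fiber_lt {V C : Type*} [DecidableEq V] [DecidableEq C] {a : ℝ}
    (ha : 0 < a) {G : SimpleGraph V}
    (hG : ∀ U W : Finset V, Disjoint U W → a ≤ U.card → a ≤ W.card →
      ∃ u ∈ U, ∃ w ∈ W, G.Adj u w)
    {L R : Finset V} (hLR : Disjoint L R) (hL : 3 * a ≤ L.card) (hR : 3 * a ≤ R.card)
    (f : V → C) (hf : ∀ x ∈ L, ∀ y ∈ R, G.Adj x y → f x = f y)
    (hfib : ∀ (A : Finset V) (c : C), ((A.filter (f · = c)).card : ℝ) < a) (T : Finset C) :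
    ((L.filter (f · ∈ T)).card : ℝ) < a ∧ ((R.filter (f · ∈ T)).card : ℝ) < a := by
  induction T using Finset.induction_on with
  | empty => simpa using ha
  | insert c T _ ih =>
    have bound (A : Finset V) : ((A.filter (f · ∈ insert c T)).card : ℝ) ≤
        (A.filter (f · = c)).card + (A.filter (f · ∈ T)).card := by
      simp only [Finset.mem_insert, Finset.filter_or]
      exact_mod_cast Finset.card_union_le _ _
    have split (A : Finset V) : ((A.filter (f · ∈ insert c T)).card : ℝ) +
        (A.filter (¬ f · ∈ insert c T)).card = A.card := by
      exact_mod_cast Finset.card_filter_add_card_filter_not (s := A) (f · ∈ insert c T)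
    have hbL := bound L
    have hbR := bound R
    have hsL := split L
    have hsR := split R
    have hcL := hfib L c
    have hcR := hfib R c
    constructor
    · by_contra! h
      obtain ⟨u, hu, w, hw, huw⟩ := hG (L.filter (f · ∈ insert c T))
        (R.filter (¬ f · ∈ insert c T)) (Finset.disjoint_filter_filter hLR) h (by linarith)
      rw [Finset.mem_filter] at hu hw
      exact hw.2 (hf u hu.1 w hw.1 huw ▸ hu.2)
    · by_contra! h
      obtain ⟨u, hu, w, hw, huw⟩ := hG (R.filter (f · ∈ insert c T))
        (L.filter (¬ f · ∈ insert c T)) (Finset.disjoint_filter_filter hLR.symm) h (by linarith)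
      rw [Finset.mem_filter] at hu hw
      exact hw.2 ((hf w hw.1 u hu.1 huw.symm).symm ▸ hu.2)

theorem stmt10 {V : Type*} [Fintype V] (n : ℕ) (hcard : Fintype.card V = n)
    (G : SimpleGraph V)
    (hP1 : ∀ U W : Finset V, Disjoint U W →
      (n : ℝ) / 15 ≤ U.card → (n : ℝ) / 15 ≤ W.card →
      ∃ u ∈ U, ∃ w ∈ W, G.Adj u w)
    (L R : Finset V) (hLR : Disjoint L R)
    (hL : (n : ℝ) / 5 ≤ L.card) (hR : (n : ℝ) / 5 ≤ R.card) :
    ∃ c : (SimpleGraph.fromRel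
        (fun x y => G.Adj x y ∧ x ∈ L ∧ y ∈ R)).ConnectedComponent,
      (n : ℝ) / 15 ≤ c.supp.ncard := by
  classical
  have hn : 0 < n := by
    by_contra! h
    obtain rfl : n = 0 := by omega
    obtain ⟨u, hu, -⟩ := hP1 ∅ ∅ (by simp) (by simp) (by simp)
    simp at hu
  have ha : (0 : ℝ) < n / 15 := by positivity
  by_contra! hsmall
  set H := SimpleGraph.fromRel (fun x y => G.Adj x y ∧ x ∈ L ∧ y ∈ R)
  have key := card_filter_mem_lt_of_fiber_lt ha hP1 hLR (by linarith) (by linarith)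
    H.connectedComponentMk
    (fun x hx y hy hxy => SimpleGraph.ConnectedComponent.sound
      (SimpleGraph.Adj.reachable
        ((SimpleGraph.fromRel_adj _ _ _).2 ⟨hxy.ne, Or.inl ⟨hxy, hx, hy⟩⟩)))
    (fun A c => by
      refine lt_of_le_of_lt ?_ (hsmall c)
      rw [← Set.ncard_coe_finset]
      refine Nat.cast_le.2 (Set.ncard_le_ncard (fun x hx => ?_) (Set.toFinite _))
      exact (Finset.mem_filter.1 hx).2)
    (L.image H.connectedComponentMk)
  have hall : L.filter (H.connectedComponentMk · ∈ L.image H.connectedComponentMk) = L :=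
    Finset.filter_true_of_mem fun x hx => Finset.mem_image_of_mem _ hx
  rw [hall] at key
  linarith [key.1]
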